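/- Let R > 0 and let μ, λ be real numbers. Suppose μ ≤ −3(2R)^{2/3} and λ > −μ²/12 + (√(μ(μ³ − 864R²))/6)·cos((ϑ − π)/3), where ϑ = arccos((−μ⁶ − 2160R²μ³ + 93312R⁴)/(μ(864R² − μ³)·√(μ(μ³ − 864R²)))). Then the cubic equation x³ − μx² − λx + 4R² = 0 has two distinct positive real solutions. -/

import Mathlib

/-- A monic cubic that is positive at `0` and negative at some `t > 0`
has two distinct positive roots. -/
theorem exists_two_pos_roots_of_neg {m l d t : ℝ} (hm : 0 < m) (hd : 0 < d) (ht : 0 < t)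
    (hneg : t ^ 3 + m * t ^ 2 - l * t + d < 0) :
    ∃ x y : ℝ, 0 < x ∧ 0 < y ∧ x ≠ y ∧
      x ^ 3 + m * x ^ 2 - l * x + d = 0 ∧ y ^ 3 + m * y ^ 2 - l * y + d = 0 := by
  have hc : Continuous fun x : ℝ => x ^ 3 + m * x ^ 2 - l * x + d := by fun_prop
  have hl := abs_nonneg l
  have hl' := le_abs_self l
  set T := t + |l| + 1 with hT
  have hT1 : 1 ≤ T := by linarith
  have hTpos : 0 < T ^ 3 + m * T ^ 2 - l * T + d := by
    have h1 : 0 ≤ T ^ 2 - l := by nlinarith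
    have h2 : 0 ≤ T * (T ^ 2 - l) := mul_nonneg (by linarith) h1
    have h3 : 0 ≤ m * T ^ 2 := by positivity
    linarith [show T * (T ^ 2 - l) = T ^ 3 - l * T by ring]
  obtain ⟨x, hx, hx0⟩ := intermediate_value_Ioo' ht.le hc.continuousOn
    (show (0 : ℝ) ∈ Set.Ioo _ _ from ⟨hneg, by simpa using hd⟩)
  obtain ⟨y, hy, hy0⟩ := intermediate_value_Ioo (show t ≤ T by linarith) hc.continuousOn
    (show (0 : ℝ) ∈ Set.Ioo _ _ from ⟨hneg, hTpos⟩)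
  exact ⟨x, y, hx.1, ht.trans hy.1, (hx.2.trans hy.1).ne, hx0, hy0⟩

/-- The equation `2 t³ + m t² = d` has a positive solution when `m, d > 0`. -/
theorem exists_pos_two_mul_cube_add {m d : ℝ} (hm : 0 < m) (hd : 0 < d) :
    ∃ t : ℝ, 0 < t ∧ 2 * t ^ 3 + m * t ^ 2 = d := by
  have hc : Continuous fun x : ℝ => 2 * x ^ 3 + m * x ^ 2 := by fun_prop
  have hT : d < 2 * (d + 1) ^ 3 + m * (d + 1) ^ 2 := by
    have : 0 < m * (d + 1) ^ 2 := by positivity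
    nlinarith [pow_pos hd 2, pow_pos hd 3]
  obtain ⟨t, ht, h⟩ := intermediate_value_Ioo (show (0 : ℝ) ≤ d + 1 by linarith) hc.continuousOn
    (show d ∈ Set.Ioo _ _ from ⟨by simpa using hd, hT⟩)
  exact ⟨t, ht.1, h⟩

/-- The trigonometric root formula gives an upper bound for the real roots of a depressed cubic. -/
theorem le_mul_cos_of_depressed_cubic {w q z θ : ℝ} (hw : 0 < w) (hq : |q| ≤ w ^ 3)
    (hθ : θ = Real.arccos (-(q / w ^ 3))) (hz : 864 * z ^ 3 - 18 * w ^ 2 * z = q) :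
    z ≤ w / 6 * Real.cos ((θ - Real.pi) / 3) := by
  have hw3 : 0 < w ^ 3 := by positivity
  obtain ⟨hq1, hq2⟩ := abs_le.mp hq
  have hcos : Real.cos (θ - Real.pi) = q / w ^ 3 := by
    rw [Real.cos_sub_pi, hθ, Real.cos_arccos, neg_neg]
    · rw [neg_le_neg_iff, div_le_one hw3]; exact hq2
    · rw [neg_le, le_div_iff₀ hw3]; linarith
  have hc : 1 / 2 ≤ Real.cos ((θ - Real.pi) / 3) := by
    have h0 : 0 ≤ θ := hθ ▸ Real.arccos_nonneg _
    have h1 : θ ≤ Real.pi := hθ ▸ Real.arccos_le_pi _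
    rw [← Real.cos_pi_div_three, ← Real.cos_neg ((θ - Real.pi) / 3)]
    exact Real.cos_le_cos_of_nonneg_of_le_pi (by linarith) (by linarith [Real.pi_pos])
      (by linarith)
  have h3 := Real.cos_three_mul ((θ - Real.pi) / 3)
  rw [mul_div_cancel₀ _ (three_ne_zero' ℝ), hcos, div_eq_iff hw3.ne'] at h3
  set c := Real.cos ((θ - Real.pi) / 3)
  by_contra! hlt
  set b := w / 6 * c with hb
  have hbw : w / 12 ≤ b := by rw [hb]; nlinarith
  have hbq : 864 * b ^ 3 - 18 * w ^ 2 * b = q := by rw [h3, hb]; ring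
  have hprod : (z - b) * (864 * (z ^ 2 + z * b + b ^ 2) - 18 * w ^ 2) = 0 := by
    linear_combination hz - hbq
  have hpos : 0 < 864 * (z ^ 2 + z * b + b ^ 2) - 18 * w ^ 2 := by
    nlinarith [mul_pos (sub_pos.mpr hlt) hw]
  exact (mul_pos (sub_pos.mpr hlt) hpos).ne' hprod

/-- If `μ ≤ -3(2R)^(2/3)` and `λ` exceeds the stated trigonometric bound,
then `x³ - μx² - λx + 4R² = 0` has two distinct positive real solutions. -/
theorem stmt1 (R μ lam θ : ℝ) (hR : 0 < R)
    (hθ : θ = Real.arccos ((-μ ^ 6 - 2160 * R ^ 2 * μ ^ 3 + 93312 * R ^ 4) /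
      (μ * (864 * R ^ 2 - μ ^ 3) * Real.sqrt (μ * (μ ^ 3 - 864 * R ^ 2)))))
    (hμ : μ ≤ -3 * (2 * R) ^ ((2 : ℝ) / 3))
    (hlam : lam > -μ ^ 2 / 12 +
      Real.sqrt (μ * (μ ^ 3 - 864 * R ^ 2)) / 6 * Real.cos ((θ - Real.pi) / 3)) :
    ∃ x y : ℝ, 0 < x ∧ 0 < y ∧ x ≠ y ∧
      x ^ 3 - μ * x ^ 2 - lam * x + 4 * R ^ 2 = 0 ∧
      y ^ 3 - μ * y ^ 2 - lam * y + 4 * R ^ 2 = 0 := by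
  obtain ⟨m, rfl⟩ : ∃ m, μ = -m := ⟨-μ, (neg_neg μ).symm⟩
  have hs : 0 < R ^ 2 := by positivity
  have hp : 0 < (2 * R) ^ ((2 : ℝ) / 3) := by positivity
  have hm : 0 < m := by linarith
  have hm3 : 108 * R ^ 2 ≤ m ^ 3 := by
    have hcube : ((2 * R) ^ ((2 : ℝ) / 3)) ^ 3 = (2 * R) ^ 2 := by
      rw [← Real.rpow_natCast, ← Real.rpow_mul (by positivity), ← Real.rpow_natCast]
      norm_num
    have h := pow_le_pow_left₀ (by positivity)
      (show 3 * (2 * R) ^ ((2 : ℝ) / 3) ≤ m by linarith) 3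
    rw [mul_pow, hcube] at h
    linarith
  have hD : 0 < -m * ((-m) ^ 3 - 864 * R ^ 2) := by
    have : 0 < m ^ 4 + 864 * m * R ^ 2 := by positivity
    linarith
  set w := Real.sqrt (-m * ((-m) ^ 3 - 864 * R ^ 2)) with hwdef
  have hw : 0 < w := Real.sqrt_pos.mpr hD
  have hw2 : w ^ 2 = m ^ 4 + 864 * m * R ^ 2 := by
    rw [hwdef, Real.sq_sqrt hD.le]; ring
  set q := -m ^ 6 + 2160 * R ^ 2 * m ^ 3 + 93312 * R ^ 4 with hq
  have hθ' : θ = Real.arccos (-(q / w ^ 3)) := by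
    rw [hθ, ← div_neg]
    congr 2
    · rw [hq]; ring
    · linear_combination w * hw2
  have hqw : |q| ≤ w ^ 3 := by
    apply abs_le_of_sq_le_sq _ (by positivity)
    have hdisc : (w ^ 3) ^ 2 - q ^ 2 = 6912 * R ^ 2 * (m ^ 3 - 108 * R ^ 2) ^ 3 := by
      rw [show (w ^ 3) ^ 2 = (w ^ 2) ^ 3 by ring, hw2, hq]; ring
    have : 0 ≤ 6912 * R ^ 2 * (m ^ 3 - 108 * R ^ 2) ^ 3 :=
      mul_nonneg (by positivity) (pow_nonneg (by linarith) 3)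
    linarith
  obtain ⟨t, ht, hts⟩ := exists_pos_two_mul_cube_add hm (show 0 < 4 * R ^ 2 by positivity)
  have hs' : R ^ 2 = (2 * t ^ 3 + m * t ^ 2) / 4 := by linarith
  have hz := le_mul_cos_of_depressed_cubic (z := 3 * t ^ 2 + 2 * m * t + m ^ 2 / 12) hw hqw hθ'
    (by rw [hw2, hq, show R ^ 4 = (R ^ 2) ^ 2 by ring, hs']; ring)
  have hlt : 3 * t ^ 2 + 2 * m * t < lam := by linarith [neg_sq m]
  obtain ⟨x, y, hx, hy, hxy, hx0, hy0⟩ :=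
    exists_two_pos_roots_of_neg (l := lam) hm (show 0 < 4 * R ^ 2 by positivity) ht
      (by nlinarith [mul_pos ht (sub_pos.mpr hlt)])
  exact ⟨x, y, hx, hy, hxy, by linarith, by linarith⟩
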